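/- Orthogonality over the unit sphere: define the unified family ψ_k^l for k ∈ ℤ ∖ {−1} by ψ_k^l = A_k^l (inner Appell polynomial) for k ≥ 0 and 0 ≤ l ≤ k, and ψ_k^l = A_k^l (outer Appell function with n = −k−2) for k ≤ −2 and 0 ≤ l ≤ −k−2. Then for all admissible (k, l) ≠ (q, m), ∫_{S²} conj(ψ_k^l(ω))·ψ_q^m(ω) dσ(ω) = 0; in particular every inner Appell polynomial is orthogonal over S² to every outer Appell function. Moreover for all 0 ≤ l ≤ n, ∫_{S²} |A_n^l(ω)|² dσ(ω) = (2n+3)·∫_{B⁺} |A_n^l(x)|² dx. -/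

import Mathlib

open MeasureTheory Metric Finset

noncomputable section

/-- `ℝ³` with the Euclidean norm and Lebesgue measure. -/
abbrev R3 := EuclideanSpace ℝ (Fin 3)
/-- the real quaternions ℍ -/
abbrev QH := Quaternion ℝ

/-- the basis quaternion e₁ -/
def e1 : QH := ⟨0,1,0,0⟩
/-- the basis quaternion e₂ -/
def e2 : QH := ⟨0,0,1,0⟩
/-- the basis quaternion e₃ -/
def e3 : QH := ⟨0,0,0,1⟩

/-- embed a point of ℝ³ as the reduced quaternion x₀ + x₁e₁ + x₂e₂ -/
def toQ (x : R3) : QH := ⟨x 0, x 1, x 2, 0⟩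
/-- the conjugate reduced quaternion x₀ - x₁e₁ - x₂e₂ -/
def toQbar (x : R3) : QH := ⟨x 0, -(x 1), -(x 2), 0⟩
/-- ζ = x₁ - x₂e₃ -/
def zeta (x : R3) : QH := ⟨x 1, 0, 0, -(x 2)⟩

/-- build a point of ℝ³ from coordinates -/
def mk3 (a b c : ℝ) : R3 := (WithLp.equiv 2 (Fin 3 → ℝ)).symm ![a, b, c]

/-- the conjugated point (x₀, -x₁, -x₂) -/
def barPt (x : R3) : R3 := mk3 (x 0) (-(x 1)) (-(x 2))

/-- partial derivative ∂f/∂xᵢ -/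
def pd (i : Fin 3) (f : R3 → QH) (x : R3) : QH :=
  fderiv ℝ f x (EuclideanSpace.single i 1)

/-- the generalized Cauchy-Riemann operator ∂̄f = ∂f/∂x₀ + e₁∂f/∂x₁ + e₂∂f/∂x₂ -/
def CRbar (f : R3 → QH) (x : R3) : QH :=
  pd 0 f x + e1 * pd 1 f x + e2 * pd 2 f x

/-- the adjoint generalized Cauchy-Riemann operator ∂f = ∂f/∂x₀ - e₁∂f/∂x₁ - e₂∂f/∂x₂ -/
def Dadj (f : R3 → QH) (x : R3) : QH :=
  pd 0 f x - e1 * pd 1 f x - e2 * pd 2 f x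

/-- the hypercomplex derivative ∂₀ = (1/2)∂ -/
def D0 (f : R3 → QH) : R3 → QH := fun x =>
  (1/2 : ℝ) • (pd 0 f x - e1 * pd 1 f x - e2 * pd 2 f x)

/-- the operator ∂̄_ℂ f = (1/2)(∂f/∂x₁ + e₃∂f/∂x₂) -/
def DbarC (f : R3 → QH) : R3 → QH := fun x =>
  (1/2 : ℝ) • (pd 1 f x + e3 * pd 2 f x)

/-- the involution f⁰ + f¹e₁ + f²e₂ + f³e₃ ↦ f⁰ - f¹e₁ - f²e₂ + f³e₃ -/
def invol (a : QH) : QH := ⟨a.re, -a.imI, -a.imJ, a.imK⟩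

/-- the inner Appell polynomial A_n^l -/
def appell (n l : ℕ) (x : R3) : QH :=
  ((n.factorial * l.factorial : ℝ) /
      (2 ^ (2 * (n - l)) * (n + l + 1).factorial * (2 * l).factorial)) •
    ((∑ h ∈ Finset.range (n - l + 1),
        (((2 * n - 2 * h + 1).factorial * (2 * l + 2 * h).factorial : ℝ) /
            (h.factorial * (n - l - h).factorial * (n - h).factorial * (l + h).factorial)) •
          (toQbar x ^ h * toQ x ^ (n - l - h))) * zeta x ^ l)

/-- the Kelvin transform K(P)(x) = (x̄/|x|³)·P(x̄/|x|²) -/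
def kelvin (P : R3 → QH) (x : R3) : QH :=
  ((‖x‖ ^ 3)⁻¹ • toQbar x) * P ((‖x‖ ^ 2)⁻¹ • barPt x)

/-- the outer Appell function A_{-(n+2)}^l -/
def outerAppell (n l : ℕ) (x : R3) : QH :=
  (((n + l + 1).factorial * (n - l).factorial : ℝ) / (n.factorial * (n + 1).factorial)) •
    kelvin (appell n l) x

/-- surface integral over the sphere of radius ρ (parametrized by the unit sphere
with its surface measure, with the Jacobian factor ρ²) -/
def sphereIntegral (ρ : ℝ) (g : R3 → QH) : QH :=
  ∫ ω : sphere (0 : R3) 1, (ρ ^ 2) • g (ρ • (ω : R3)) ∂((volume : Measure R3).toSphere)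

/-- the unified family ψ_k^l, k ∈ ℤ \ {-1}: inner Appell polynomials for k ≥ 0,
outer Appell functions for k ≤ -2 -/
def psiFam (k : ℤ) (l : ℕ) (x : R3) : QH :=
  if 0 ≤ k then appell k.toNat l x else outerAppell (-k - 2).toNat l x

section SphereIntegral

variable {E : Type*} [NormedAddCommGroup E] [NormedSpace ℝ E]

/-- Integration in polar coordinates of a function that is a radial factor times an angular one. -/
theorem integral_polar (F f : R3 → E) (φ : ℝ → ℝ)
    (hF : ∀ r : ℝ, 0 < r → ∀ ω : R3, ‖ω‖ = 1 → F (r • ω) = φ r • f ω) :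
    ∫ x, F x = (∫ r in Set.Ioi (0 : ℝ), r ^ 2 * φ r) •
      ∫ ω : sphere (0 : R3) 1, f ω ∂(volume : Measure R3).toSphere := by
  have hdim : Module.finrank ℝ R3 - 1 = 2 := by simp
  have hp := (volume : Measure R3).measurePreserving_homeomorphUnitSphereProd
  rw [hdim] at hp
  calc
    ∫ x, F x = ∫ x : ({(0)}ᶜ : Set R3), F (x : R3) ∂((volume : Measure R3).comap (↑)) := by
      rw [integral_subtype_comap (measurableSet_singleton _).compl F, restrict_compl_singleton]
    _ = ∫ p, φ p.2 • f p.1 ∂(volume : Measure R3).toSphere.prod (.volumeIoiPow 2) := by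
      rw [← hp.integral_comp (Homeomorph.measurableEmbedding _)
        (fun p : sphere (0 : R3) 1 × Set.Ioi (0 : ℝ) => φ p.2 • f p.1)]
      refine integral_congr_ae (.of_forall fun x => ?_)
      have hx : 0 < ‖(x : R3)‖ := norm_pos_iff.2 x.2
      simp only [homeomorphUnitSphereProd_apply_snd_coe, homeomorphUnitSphereProd_apply_fst_coe]
      rw [← hF _ hx _ (by rw [norm_smul, norm_inv, norm_norm, inv_mul_cancel₀ hx.ne']),
        smul_inv_smul₀ hx.ne']
    _ = ∫ p, φ p.1 • f p.2
          ∂(Measure.volumeIoiPow 2).prod (volume : Measure R3).toSphere := by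
      rw [← integral_prod_swap]; rfl
    _ = _ := by
      rw [integral_prod_smul (fun r : Set.Ioi (0 : ℝ) => φ r)
        (fun ω : sphere (0 : R3) 1 => f ω)]
      congr 1
      simp only [Measure.volumeIoiPow, ENNReal.ofReal]
      rw [integral_withDensity_eq_integral_smul
          (measurable_subtype_coe.pow_const _).real_toNNReal,
        integral_subtype_comap measurableSet_Ioi fun a ↦ Real.toNNReal (a ^ 2) • φ a]
      refine setIntegral_congr_fun measurableSet_Ioi fun x _ ↦ ?_
      simp only [NNReal.smul_def, Real.coe_toNNReal _ (sq_nonneg x), smul_eq_mul]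

theorem integral_pow_mul_exp_neg_sq (p : ℕ) :
    ∫ r in Set.Ioi (0 : ℝ), r ^ p * Real.exp (-r ^ 2) = 1 / 2 * Real.Gamma ((p + 1) / 2) := by
  have h := integral_rpow_mul_exp_neg_rpow (p := 2) (q := p) two_pos
    (by have : (0 : ℝ) ≤ p := p.cast_nonneg
        linarith)
  simpa only [Real.rpow_natCast, Real.rpow_two] using h

/-- The surface measure of the unit sphere is invariant under linear isometries. -/
theorem integral_sphere_comp_isometry (R : R3 ≃ₗᵢ[ℝ] R3) (f : R3 → E) :
    ∫ ω : sphere (0 : R3) 1, f (R ω) ∂(volume : Measure R3).toSphere =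
      ∫ ω : sphere (0 : R3) 1, f ω ∂(volume : Measure R3).toSphere := by
  have key : ∀ g : R3 → E, ∫ x : R3, Real.exp (-‖x‖ ^ 2) • g (‖x‖⁻¹ • x) =
      (∫ r in Set.Ioi (0 : ℝ), r ^ 2 * Real.exp (-r ^ 2)) •
        ∫ ω : sphere (0 : R3) 1, g ω ∂(volume : Measure R3).toSphere := fun g =>
    integral_polar _ g _ fun r hr ω hω => by
      simp [norm_smul, hω, abs_of_pos hr, smul_smul, hr.ne']
  have hne : (∫ r in Set.Ioi (0 : ℝ), r ^ 2 * Real.exp (-r ^ 2)) ≠ 0 := by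
    rw [integral_pow_mul_exp_neg_sq]
    exact mul_ne_zero (by norm_num) (Real.Gamma_pos_of_pos (by norm_num)).ne'
  refine smul_right_injective E hne ?_
  simp only
  rw [← key, ← key (fun x => f (R x)), ← R.measurePreserving.integral_comp
    R.toHomeomorph.measurableEmbedding (fun x => Real.exp (-‖x‖ ^ 2) • f (‖x‖⁻¹ • x))]
  simp

end SphereIntegral

theorem integral_sphere_odd_pow (p : ℕ) (hp : Odd p) :
    ∫ ω : sphere (0 : R3) 1, (ω : R3) 0 ^ p ∂(volume : Measure R3).toSphere = 0 := by
  have h := integral_sphere_comp_isometry (LinearIsometryEquiv.neg ℝ) (fun x : R3 => x 0 ^ p)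
  simp only [LinearIsometryEquiv.coe_neg, PiLp.neg_apply, hp.neg_pow, integral_neg] at h
  linarith

theorem integral_even_pow_mul_exp_neg_sq (k : ℕ) :
    ∫ t : ℝ, t ^ (2 * k) * Real.exp (-t ^ 2) = Real.Gamma (k + 1 / 2) := by
  have h := integral_comp_abs (f := fun t : ℝ => t ^ (2 * k) * Real.exp (-t ^ 2))
  simp only [pow_mul, sq_abs] at h
  simp only [← pow_mul] at h
  rw [h, integral_pow_mul_exp_neg_sq]
  push_cast
  rw [show ((2 * k + 1) / 2 : ℝ) = k + 1 / 2 by ring]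
  ring

theorem integral_sphere_even_pow (k : ℕ) :
    ∫ ω : sphere (0 : R3) 1, (ω : R3) 0 ^ (2 * k) ∂(volume : Measure R3).toSphere =
      4 * Real.pi / (2 * k + 1) := by
  have h := integral_polar (fun x : R3 => x 0 ^ (2 * k) * Real.exp (-‖x‖ ^ 2))
    (fun x => x 0 ^ (2 * k)) (fun r => r ^ (2 * k) * Real.exp (-r ^ 2)) (fun r hr ω hω => by
      simp [norm_smul, hω, abs_of_pos hr]; ring)
  simp only [← mul_assoc, ← pow_add] at h
  rw [integral_pow_mul_exp_neg_sq] at h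
  have h2 : ∫ x : R3, x 0 ^ (2 * k) * Real.exp (-‖x‖ ^ 2) =
      Real.Gamma (k + 1 / 2) * Real.pi := by
    rw [← (PiLp.volume_preserving_toLp (Fin 3)).integral_comp
      (MeasurableEquiv.toLp 2 (Fin 3 → ℝ)).measurableEmbedding]
    have h3 := integral_fintype_prod_volume_eq_prod (ι := Fin 3) (𝕜 := ℝ) (E := fun _ => ℝ)
      (fun i t => t ^ (2 * (if i = 0 then k else 0)) * Real.exp (-t ^ 2))
    simp only [integral_even_pow_mul_exp_neg_sq] at h3
    simp only [Fin.prod_univ_three] at h3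
    have h4 : Real.Gamma (1 / 2) * Real.Gamma (1 / 2) = Real.pi := by
      rw [Real.Gamma_one_half_eq, Real.mul_self_sqrt Real.pi_pos.le]
    simp only [if_true, Fin.isValue, one_ne_zero, if_false, show (2 : Fin 3) ≠ 0 by decide,
      Nat.cast_zero, zero_add, mul_assoc, h4] at h3
    rw [← h3]
    refine integral_congr_ae (.of_forall fun x => ?_)
    simp only [EuclideanSpace.norm_sq_eq, Fin.sum_univ_three, Real.norm_eq_abs, sq_abs, neg_add,
      Real.exp_add]
    ring
  rw [h2, show (((2 + 2 * k : ℕ) : ℝ) + 1) / 2 = (k + 1 / 2) + 1 by push_cast; ring,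
    Real.Gamma_add_one (by positivity)] at h
  have hG : 0 < Real.Gamma ((k : ℝ) + 1 / 2) := Real.Gamma_pos_of_pos (by positivity)
  rw [smul_eq_mul] at h
  have hk : (0 : ℝ) < 2 * k + 1 := by positivity
  rw [eq_div_iff hk.ne']
  have := mul_left_cancel₀ hG.ne' (h.trans
    (by ring : _ = Real.Gamma ((k : ℝ) + 1 / 2) * (1 / 2 * (k + 1 / 2) *
      ∫ ω : sphere (0 : R3) 1, (ω : R3) 0 ^ (2 * k) ∂(volume : Measure R3).toSphere)))
  linarith

section Moments

open Polynomial

theorem integrable_sphere {E : Type*} [NormedAddCommGroup E] {f : R3 → E} (hf : Continuous f) :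
    Integrable (fun ω : sphere (0 : R3) 1 => f ω) (volume : Measure R3).toSphere :=
  (hf.comp continuous_subtype_val).integrable_of_hasCompactSupport
    (HasCompactSupport.of_compactSpace _)

theorem continuous_eval_coord (p : ℝ[X]) : Continuous fun x : R3 => p.eval (x 0) :=
  p.continuous.comp (by fun_prop)

/-- Archimedes' theorem for polynomials: the first coordinate is uniformly distributed. -/
theorem integral_sphere_derivative (p : ℝ[X]) :
    ∫ ω : sphere (0 : R3) 1, (derivative p).eval ((ω : R3) 0) ∂(volume : Measure R3).toSphere =
      2 * Real.pi * (p.eval 1 - p.eval (-1)) := by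
  induction p using Polynomial.induction_on' with
  | add p q hp hq =>
    simp only [derivative_add, eval_add]
    rw [integral_add (integrable_sphere (continuous_eval_coord _))
      (integrable_sphere (continuous_eval_coord _)), hp, hq]
    ring
  | monomial n a =>
    simp only [derivative_monomial, eval_monomial]
    rw [integral_const_mul]
    rcases n.eq_zero_or_pos with rfl | hn
    · simp
    obtain ⟨m, rfl⟩ := Nat.exists_eq_succ_of_ne_zero hn.ne'
    simp only [Nat.succ_eq_add_one, Nat.add_sub_cancel]
    rcases Nat.even_or_odd' m with ⟨k, rfl | rfl⟩
    · rw [integral_sphere_even_pow, Odd.neg_one_pow ⟨k, rfl⟩]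
      have : (0 : ℝ) < 2 * k + 1 := by positivity
      push_cast
      field_simp
      ring
    · rw [integral_sphere_odd_pow _ ⟨k, rfl⟩, Even.neg_one_pow ⟨k + 1, by ring⟩]
      simp

/-- The moments of the Chebyshev polynomials against the weight `(1 - x₀²) ^ l` on the sphere. -/
def chebMoment (l : ℕ) (K : ℤ) : ℝ :=
  ∫ ω : sphere (0 : R3) 1, ((1 - X ^ 2) ^ l * Chebyshev.T ℝ K).eval ((ω : R3) 0)
    ∂(volume : Measure R3).toSphere

theorem chebMoment_neg (l : ℕ) (K : ℤ) : chebMoment l (-K) = chebMoment l K := by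
  simp only [chebMoment, Chebyshev.T_neg]

theorem chebMoment_of_odd (l : ℕ) {K : ℤ} (hK : Odd K) : chebMoment l K = 0 := by
  have h := integral_sphere_comp_isometry (LinearIsometryEquiv.neg ℝ)
    (fun x : R3 => ((1 - X ^ 2) ^ l * Chebyshev.T ℝ K).eval (x 0))
  have h2 : ∀ t : ℝ, ((1 - X ^ 2) ^ l * Chebyshev.T ℝ K).eval (-t) =
      -((1 - X ^ 2) ^ l * Chebyshev.T ℝ K).eval t := fun t => by
    simp [Chebyshev.T_eval_neg, Int.negOnePow_odd K hK]
  simp only [LinearIsometryEquiv.coe_neg, PiLp.neg_apply, h2, integral_neg] at h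
  rw [chebMoment]
  linarith

theorem chebMoment_add_two (l : ℕ) (K : ℤ) :
    (K + 2 * l + 3) * chebMoment l (K + 2) = (K - 2 * l - 1) * chebMoment l K := by
  have h := integral_sphere_derivative ((1 - X ^ 2) ^ (l + 1) * Chebyshev.T ℝ (K + 1))
  have hd : derivative ((1 - X ^ 2) ^ (l + 1) * Chebyshev.T ℝ (K + 1)) =
      C ((K - 2 * l - 1 : ℝ) / 2) * ((1 - X ^ 2) ^ l * Chebyshev.T ℝ K) -
      C ((K + 2 * l + 3 : ℝ) / 2) * ((1 - X ^ 2) ^ l * Chebyshev.T ℝ (K + 2)) := by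
    have h1 := Chebyshev.one_sub_X_sq_mul_derivative_T_eq_poly_in_T (R := ℝ) K
    have h2 := Chebyshev.T_add_two ℝ K
    refine Polynomial.funext fun t => ?_
    have h1' := congrArg (eval t) h1
    have h2' := congrArg (eval t) h2
    simp only [derivative_mul, derivative_pow, derivative_sub, derivative_one, derivative_X,
      eval_add, eval_mul, eval_sub, eval_pow, eval_X, eval_one, eval_C, eval_zero,
      eval_intCast, eval_ofNat, Nat.add_sub_cancel] at h1' h2' ⊢
    push_cast
    rw [h2']
    linear_combination (1 - t ^ 2) ^ l * h1'
  rw [hd] at h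
  simp only [eval_sub, eval_C_mul] at h
  rw [integral_sub ((integrable_sphere (continuous_eval_coord _)).const_mul _)
    ((integrable_sphere (continuous_eval_coord _)).const_mul _), integral_const_mul,
    integral_const_mul] at h
  simp only [← chebMoment.eq_1] at h
  simp at h
  linarith

theorem int_add_half_ne_neg_nat (z : ℤ) (m : ℕ) : (z : ℝ) + 1 / 2 ≠ -m := by
  intro h
  have h2 : ((2 * z + 1 + 2 * m : ℤ) : ℝ) = 0 := by push_cast; linarith
  have h3 : 2 * z + 1 + 2 * (m : ℤ) = 0 := by exact_mod_cast h2
  omega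

theorem gamma_int_add_half_ne_zero (z : ℤ) : Real.Gamma (z + 1 / 2) ≠ 0 :=
  Real.Gamma_ne_zero (int_add_half_ne_neg_nat z)

theorem gamma_int_add_half_succ (z : ℤ) :
    Real.Gamma ((z + 1 : ℤ) + 1 / 2) = (z + 1 / 2) * Real.Gamma (z + 1 / 2) := by
  rw [← Real.Gamma_add_one (by simpa using int_add_half_ne_neg_nat z 0)]
  push_cast
  ring_nf

theorem gamma_int_add_half_add_nat (z : ℤ) (j : ℕ) :
    Real.Gamma ((z + j : ℤ) + 1 / 2) =
      (ascPochhammer ℝ j).eval ((z : ℝ) + 1 / 2) * Real.Gamma (z + 1 / 2) := by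
  induction j with
  | zero => simp
  | succ j ih =>
    rw [show z + ((j + 1 : ℕ) : ℤ) = (z + j) + 1 by push_cast; ring, gamma_int_add_half_succ, ih,
      ascPochhammer_succ_eval]
    push_cast
    ring

theorem chebMoment_mul_gamma (l : ℕ) (k : ℤ) :
    chebMoment l (2 * k) * (Real.Gamma ((l + 1 + k : ℤ) + 1 / 2) *
      Real.Gamma ((l + 1 - k : ℤ) + 1 / 2)) =
      (-1) ^ k * (chebMoment l 0 * Real.Gamma ((l + 1 : ℤ) + 1 / 2) ^ 2) := by
  have step : ∀ k : ℤ, chebMoment l (2 * (k + 1)) *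
      (Real.Gamma ((l + 1 + (k + 1) : ℤ) + 1 / 2) *
        Real.Gamma ((l + 1 - (k + 1) : ℤ) + 1 / 2)) =
      -(chebMoment l (2 * k) * (Real.Gamma ((l + 1 + k : ℤ) + 1 / 2) *
        Real.Gamma ((l + 1 - k : ℤ) + 1 / 2))) := fun k => by
    have h := chebMoment_add_two l (2 * k)
    have h1 := gamma_int_add_half_succ (l + 1 + k)
    have h2 := gamma_int_add_half_succ (l - k)
    rw [show (l + 1 + (k + 1) : ℤ) = l + 1 + k + 1 by ring, h1,
      show (l + 1 - (k + 1) : ℤ) = l - k by ring, show (l + 1 - k : ℤ) = l - k + 1 by ring, h2,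
      show 2 * (k + 1) = 2 * k + 2 by ring]
    push_cast at h ⊢
    linear_combination (1 / 2) * Real.Gamma ((l + 1 + k : ℝ) + 1 / 2) *
      Real.Gamma ((l - k : ℝ) + 1 / 2) * h
  induction k using Int.induction_on with
  | zero => simp [sq]
  | succ k ih => rw [step, ih, zpow_add_one₀ (by norm_num)]; ring
  | pred k ih =>
    have h := step (-(k : ℤ) - 1)
    rw [sub_add_cancel, ih] at h
    rw [zpow_sub_one₀ (by norm_num)]
    linarith

theorem sum_neg_one_pow_mul_choose_mul_eval (p : ℝ[X]) {N : ℕ} (hp : p.natDegree < N) :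
    ∑ h ∈ range (N + 1), (-1) ^ (N - h) * (N.choose h : ℝ) * p.eval (h : ℝ) = 0 := by
  have h := congrFun (Polynomial.fwdDiff_iter_eq_zero_of_degree_lt hp) 0
  rw [fwdDiff_iter_eq_sum_shift] at h
  simpa using h

/-- The coefficient of `x̄ ^ h * x ^ (N - h)` in the Appell polynomial of degree `l + N`, up to
normalisation. -/
def appellCoeff (n l h : ℕ) : ℝ :=
  ((2 * n - 2 * h + 1).factorial * (2 * l + 2 * h).factorial : ℝ) /
    (h.factorial * (n - l - h).factorial * (n - h).factorial * (l + h).factorial)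

theorem factorial_two_mul_eq_gamma (m : ℕ) :
    ((2 * m).factorial : ℝ) * √Real.pi = 4 ^ m * m.factorial * Real.Gamma (m + 1 / 2) := by
  induction m with
  | zero => rw [Nat.cast_zero, zero_add, Real.Gamma_one_half_eq]; simp
  | succ m ih =>
    have h := gamma_int_add_half_succ m
    push_cast at h ⊢
    rw [h, show 2 * (m + 1) = 2 * m + 1 + 1 by ring]
    simp only [Nat.factorial_succ]
    push_cast
    linear_combination (2 * (m : ℝ) + 1 + 1) * (2 * m + 1) * ih

theorem appellCoeff_eq_gamma (l N h : ℕ) (hh : h ≤ N) :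
    appellCoeff (l + N) l h * (Real.pi * N.factorial) = 2 * 4 ^ (2 * l + N) * (N.choose h *
      Real.Gamma ((l + h : ℤ) + 1 / 2) * Real.Gamma ((l + N - h + 1 : ℤ) + 1 / 2)) := by
  obtain ⟨i, rfl⟩ := Nat.exists_eq_add_of_le hh
  have h1 := factorial_two_mul_eq_gamma (l + h)
  have h2 := factorial_two_mul_eq_gamma (l + i)
  have h3 := gamma_int_add_half_succ (l + i)
  rw [appellCoeff, show 2 * (l + (h + i)) - 2 * h + 1 = 2 * (l + i) + 1 by omega,
    show l + (h + i) - l - h = i by omega, show l + (h + i) - h = l + i by omega,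
    show 2 * l + 2 * h = 2 * (l + h) by ring, Nat.cast_add_choose,
    show (l + (h + i : ℕ) - h + 1 : ℤ) = l + i + 1 by push_cast; ring, h3, Nat.factorial_succ]
  push_cast at h1 h2 ⊢
  have hpi : Real.pi = √Real.pi * √Real.pi := (Real.mul_self_sqrt Real.pi_pos.le).symm
  have e1 : ((2 * (l + h)).factorial : ℝ) * ((2 * (l + i)).factorial : ℝ) * Real.pi =
      (4 ^ (l + h) * (l + h).factorial * Real.Gamma (l + h + 1 / 2)) *
        (4 ^ (l + i) * (l + i).factorial * Real.Gamma (l + i + 1 / 2)) := by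
    rw [← h1, ← h2]
    nth_rewrite 1 [hpi]
    ring
  have f1 : ((l + h).factorial : ℝ) ≠ 0 := by positivity
  have f2 : ((l + i).factorial : ℝ) ≠ 0 := by positivity
  have f3 : (h.factorial : ℝ) ≠ 0 := by positivity
  have f4 : (i.factorial : ℝ) ≠ 0 := by positivity
  generalize Real.Gamma ((l : ℝ) + h + 1 / 2) = G₁ at e1 ⊢
  generalize Real.Gamma ((l : ℝ) + i + 1 / 2) = G₂ at e1 ⊢
  field_simp
  rw [show (4 : ℝ) ^ (2 * l + (h + i)) = 4 ^ (l + h) * 4 ^ (l + i) by rw [← pow_add]; ring_nf]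
  linear_combination e1

/-- The Laurent polynomial `∑ cₕ z ^ (N - 2h)` is orthogonal to `z ^ E` for `-N ≤ E < N`. -/
theorem sum_appellCoeff_mul_chebMoment (l N : ℕ) (E : ℤ) (h1 : -N ≤ E) (h2 : E < N) :
    ∑ h ∈ range (N + 1), appellCoeff (l + N) l h * chebMoment l (N - 2 * h - E) = 0 := by
  rcases Int.even_or_odd' (N - E) with ⟨d, hd | hd⟩
  swap
  · refine sum_eq_zero fun h _ => ?_
    rw [chebMoment_of_odd l ⟨d - h, by omega⟩, mul_zero]
  obtain ⟨j, i, hN, rfl⟩ : ∃ j i : ℕ, N = j + i + 1 ∧ d = i + 1 :=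
    ⟨(N - d).toNat, (d - 1).toNat, by omega, by omega⟩
  set D := chebMoment l 0 * Real.Gamma ((l + 1 : ℤ) + 1 / 2) ^ 2
  let p : ℝ[X] := (ascPochhammer ℝ j).comp (C ((l : ℝ) + 2 + i + 1 / 2) - X) *
    (ascPochhammer ℝ i).comp (X + C ((l : ℝ) - i + 1 / 2))
  have hp : p.natDegree < N := by
    refine (natDegree_mul_le.trans (add_le_add natDegree_comp_le natDegree_comp_le)).trans_lt ?_
    have e1 : (C ((l : ℝ) + 2 + i + 1 / 2) - X : ℝ[X]).natDegree ≤ 1 := by compute_degree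
    have e2 : (X + C ((l : ℝ) - i + 1 / 2) : ℝ[X]).natDegree ≤ 1 := by compute_degree
    rw [ascPochhammer_natDegree, ascPochhammer_natDegree]
    nlinarith
  have key : ∀ h ∈ range (N + 1), appellCoeff (l + N) l h * chebMoment l (N - 2 * h - E) =
      (2 * 4 ^ (2 * l + N) * D * (-1) ^ j / (Real.pi * N.factorial)) *
        ((-1) ^ (N - h) * (N.choose h : ℝ) * p.eval (h : ℝ)) := fun h hh => by
    have hh' : h ≤ N := by simpa [Nat.lt_succ_iff] using hh
    have a := appellCoeff_eq_gamma l N h hh'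
    have m := chebMoment_mul_gamma l (i + 1 - h)
    have g1 := gamma_int_add_half_add_nat (l + 1 + (i + 1 - h)) j
    have g2 := gamma_int_add_half_add_nat (l + 1 - (i + 1 - h)) i
    have n1 := gamma_int_add_half_ne_zero (l + 1 + (i + 1 - h))
    have n2 := gamma_int_add_half_ne_zero (l + 1 - (i + 1 - h))
    rw [show (l + 1 + (i + 1 - h) + j : ℤ) = l + N - h + 1 by omega] at g1
    rw [show (l + 1 - (i + 1 - h) + i : ℤ) = l + h by omega] at g2
    rw [show (N - 2 * h - E : ℤ) = 2 * (i + 1 - h) by omega]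
    have hs : (-1 : ℝ) ^ (i + 1 - h : ℤ) = (-1) ^ j * (-1) ^ (N - h) := by
      rw [← pow_add, ← zpow_natCast, show (i + 1 - h : ℤ) = ((j + (N - h) : ℕ) : ℤ) + 2 * (-j) by
        omega, zpow_add₀ (by norm_num), zpow_mul]
      simp
    have pe : p.eval (h : ℝ) = (ascPochhammer ℝ j).eval (((l + 1 + (i + 1 - h) : ℤ) : ℝ) + 1 / 2) *
        (ascPochhammer ℝ i).eval (((l + 1 - (i + 1 - h) : ℤ) : ℝ) + 1 / 2) := by
      simp only [p, eval_mul, eval_comp, eval_sub, eval_add, eval_C, eval_X]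
      push_cast
      ring_nf
    rw [g1, g2] at a
    rw [hs] at m
    rw [pe]
    have f1 : Real.pi * N.factorial ≠ 0 := by positivity
    rw [div_mul_eq_mul_div, eq_div_iff f1]
    refine mul_right_cancel₀ (mul_ne_zero n1 n2) ?_
    linear_combination chebMoment l (2 * (i + 1 - h)) *
      (Real.Gamma (((l + 1 + (i + 1 - h) : ℤ) : ℝ) + 1 / 2) *
        Real.Gamma (((l + 1 - (i + 1 - h) : ℤ) : ℝ) + 1 / 2)) * a +
      2 * 4 ^ (2 * l + N) * (N.choose h) *
      ((ascPochhammer ℝ j).eval (((l + 1 + (i + 1 - h) : ℤ) : ℝ) + 1 / 2) *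
        (ascPochhammer ℝ i).eval (((l + 1 - (i + 1 - h) : ℤ) : ℝ) + 1 / 2)) *
      (Real.Gamma (((l + 1 + (i + 1 - h) : ℤ) : ℝ) + 1 / 2) *
        Real.Gamma (((l + 1 - (i + 1 - h) : ℤ) : ℝ) + 1 / 2)) * m
  rw [sum_congr rfl key, ← mul_sum, sum_neg_one_pow_mul_choose_mul_eval p hp, mul_zero]

end Moments

section Laurent

open scoped Quaternion

section Components

variable (x : R3)

@[simp] theorem toQ_re : (toQ x).re = x 0 := rfl
@[simp] theorem toQ_imI : (toQ x).imI = x 1 := rfl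
@[simp] theorem toQ_imJ : (toQ x).imJ = x 2 := rfl
@[simp] theorem toQ_imK : (toQ x).imK = 0 := rfl
@[simp] theorem toQbar_re : (toQbar x).re = x 0 := rfl
@[simp] theorem toQbar_imI : (toQbar x).imI = -x 1 := rfl
@[simp] theorem toQbar_imJ : (toQbar x).imJ = -x 2 := rfl
@[simp] theorem toQbar_imK : (toQbar x).imK = 0 := rfl
@[simp] theorem zeta_re : (zeta x).re = x 1 := rfl
@[simp] theorem zeta_imI : (zeta x).imI = 0 := rfl
@[simp] theorem zeta_imJ : (zeta x).imJ = 0 := rfl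
@[simp] theorem zeta_imK : (zeta x).imK = -x 2 := rfl

end Components

theorem sq_add_sq_add_sq_eq_one {x : R3} (hx : ‖x‖ = 1) : x 0 ^ 2 + x 1 ^ 2 + x 2 ^ 2 = 1 := by
  have := EuclideanSpace.norm_sq_eq x
  simpa [hx, Fin.sum_univ_three] using this.symm

theorem toQbar_mul_toQ {x : R3} (hx : ‖x‖ = 1) : toQbar x * toQ x = 1 := by
  have h := sq_add_sq_add_sq_eq_one hx
  apply Quaternion.ext <;> simp <;> linarith

theorem toQbar_eq_inv {x : R3} (hx : ‖x‖ = 1) : toQbar x = (toQ x)⁻¹ :=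
  eq_inv_of_mul_eq_one_left (toQbar_mul_toQ hx)

theorem toQ_ne_zero {x : R3} (hx : ‖x‖ = 1) : toQ x ≠ 0 :=
  right_ne_zero_of_mul_eq_one (toQbar_mul_toQ hx)

theorem toQbar_eq_star (x : R3) : toQbar x = star (toQ x) := by
  apply Quaternion.ext <;> simp

theorem star_toQ_zpow {x : R3} (hx : ‖x‖ = 1) (e : ℤ) : star (toQ x ^ e) = toQ x ^ (-e) := by
  rw [star_zpow₀, ← toQbar_eq_star, toQbar_eq_inv hx, inv_zpow, zpow_neg]

theorem toQ_zpow_add_two {x : R3} (hx : ‖x‖ = 1) (K : ℤ) :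
    toQ x ^ (K + 2) = (2 * x 0) • toQ x ^ (K + 1) - toQ x ^ K := by
  have h0 := toQ_ne_zero hx
  have h : toQ x * toQ x = (2 * x 0) • toQ x - 1 := by
    rw [← toQbar_mul_toQ hx]
    apply Quaternion.ext <;> simp <;> ring
  rw [show K + 2 = K + 1 + 1 by ring, zpow_add_one₀ h0, zpow_add_one₀ h0, mul_assoc, h, mul_sub,
    mul_smul_comm, mul_one]

theorem toQ_zpow_re_imK {x : R3} (hx : ‖x‖ = 1) (K : ℤ) :
    (toQ x ^ K).re = (Polynomial.Chebyshev.T ℝ K).eval (x 0) ∧ (toQ x ^ K).imK = 0 := by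
  induction K using Polynomial.Chebyshev.induct with
  | zero => simp
  | one => rw [zpow_one]; simp
  | add_two n h1 h2 =>
    rw [toQ_zpow_add_two hx, Polynomial.Chebyshev.T_add_two]
    simp [h1, h2, -zpow_natCast, -zpow_neg, -Polynomial.Chebyshev.T_neg]
  | neg_add_one n h1 h2 =>
    have h := toQ_zpow_add_two hx (-n - 1)
    rw [show -(n : ℤ) - 1 + 2 = -n + 1 by ring, sub_add_cancel] at h
    have h' : toQ x ^ (-(n : ℤ) - 1) = (2 * x 0) • toQ x ^ (-(n : ℤ)) - toQ x ^ (-(n : ℤ) + 1) := by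
      rw [h]; abel
    rw [h', Polynomial.Chebyshev.T_sub_one]
    simp [h1, h2, -zpow_natCast, -zpow_neg, -Polynomial.Chebyshev.T_neg]

/-- The functions `(∑ₕ aₕ x ^ eₕ) ζ ^ l`. -/
def laurentZeta (a : ℕ → ℝ) (e : ℕ → ℤ) (N l : ℕ) (x : R3) : QH :=
  (∑ h ∈ range (N + 1), a h • toQ x ^ e h) * zeta x ^ l

/-- The unit quaternion `cos β + sin β e₃`. -/
def unitK (β : ℝ) : QH := ⟨Real.cos β, 0, 0, Real.sin β⟩

@[simp] theorem unitK_re (β : ℝ) : (unitK β).re = Real.cos β := rfl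
@[simp] theorem unitK_imI (β : ℝ) : (unitK β).imI = 0 := rfl
@[simp] theorem unitK_imJ (β : ℝ) : (unitK β).imJ = 0 := rfl
@[simp] theorem unitK_imK (β : ℝ) : (unitK β).imK = Real.sin β := rfl

theorem unitK_mul (β γ : ℝ) : unitK β * unitK γ = unitK (β + γ) := by
  apply Quaternion.ext <;> simp [Real.cos_add, Real.sin_add] ; ring

theorem unitK_zero : unitK 0 = 1 := by
  apply Quaternion.ext <;> simp

theorem unitK_pow (β : ℝ) (n : ℕ) : unitK β ^ n = unitK (n * β) := by
  induction n with
  | zero => simp [unitK_zero]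
  | succ n ih => rw [pow_succ, ih, unitK_mul]; push_cast; ring_nf

theorem star_unitK (β : ℝ) : star (unitK β) = unitK (-β) := by
  apply Quaternion.ext <;> simp

theorem unitK_mul_unitK_neg (β : ℝ) : unitK β * unitK (-β) = 1 := by
  rw [unitK_mul, add_neg_cancel, unitK_zero]

theorem unitK_neg_mul_unitK (β : ℝ) : unitK (-β) * unitK β = 1 := by
  rw [unitK_mul, neg_add_cancel, unitK_zero]

/-- The rotation by the angle `β` in the `(x₁, x₂)`-plane. -/
def planeRotation (β : ℝ) : R3 ≃ₗᵢ[ℝ] R3 :=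
  LinearIsometry.toLinearIsometryEquiv
    { toFun := fun x => mk3 (x 0) (x 1 * Real.cos β - x 2 * Real.sin β)
        (x 1 * Real.sin β + x 2 * Real.cos β)
      map_add' := fun x y => by
        ext i; fin_cases i <;> simp [mk3] <;> ring
      map_smul' := fun r x => by
        ext i; fin_cases i <;> simp [mk3] <;> ring
      norm_map' := fun x => by
        simp only [EuclideanSpace.norm_eq, Fin.sum_univ_three]
        congr 1
        simp [mk3]
        linear_combination (x 1 ^ 2 + x 2 ^ 2) * Real.sin_sq_add_cos_sq β }
    rfl

theorem planeRotation_apply (β : ℝ) (x : R3) :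
    planeRotation β x = mk3 (x 0) (x 1 * Real.cos β - x 2 * Real.sin β)
      (x 1 * Real.sin β + x 2 * Real.cos β) := rfl

theorem toQ_rotation (β : ℝ) (x : R3) :
    toQ (planeRotation (2 * β) x) = unitK β * toQ x * unitK (-β) := by
  have h := Real.sin_sq_add_cos_sq β
  apply Quaternion.ext <;> simp [planeRotation_apply, mk3, Real.sin_two_mul, Real.cos_two_mul']
  · linear_combination -x 0 * h
  · ring
  · ring
  · ring

theorem zeta_rotation (β : ℝ) (x : R3) :
    zeta (planeRotation (2 * β) x) = zeta x * unitK (-β) ^ 2 := by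
  rw [unitK_pow]
  apply Quaternion.ext <;> simp [planeRotation_apply, mk3]
  ring

theorem commute_zeta_unitK (β : ℝ) (x : R3) : Commute (zeta x) (unitK β) := by
  rw [Commute, SemiconjBy]
  apply Quaternion.ext <;> simp <;> ring

theorem laurentZeta_rotation (a : ℕ → ℝ) (e : ℕ → ℤ) (N l : ℕ) (β : ℝ) (x : R3) :
    laurentZeta a e N l (planeRotation (2 * β) x) =
      unitK β * laurentZeta a e N l x * unitK (-((2 * l + 1) * β)) := by
  have hinv : unitK (-β) = (unitK β)⁻¹ := eq_inv_of_mul_eq_one_left (unitK_neg_mul_unitK β)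
  have h0 : unitK β ≠ 0 := left_ne_zero_of_mul_eq_one (unitK_mul_unitK_neg β)
  have hs : ∀ h, toQ (planeRotation (2 * β) x) ^ e h = unitK β * toQ x ^ e h * unitK (-β) := fun h => by
    have : SemiconjBy (unitK β) (toQ x) (unitK β * toQ x * (unitK β)⁻¹) := by
      rw [SemiconjBy, inv_mul_cancel_right₀ h0]
    rw [toQ_rotation, hinv, (this.zpow_right₀ (e h)).eq, mul_inv_cancel_right₀ h0]
  have hz : unitK (-β) * zeta (planeRotation (2 * β) x) ^ l =
      zeta x ^ l * unitK (-((2 * l + 1) * β)) := by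
    rw [zeta_rotation, ((commute_zeta_unitK (-β) x).pow_right 2).mul_pow, ← mul_assoc,
      ← ((commute_zeta_unitK (-β) x).pow_left l).eq, mul_assoc, ← pow_mul, ← pow_succ', unitK_pow]
    push_cast
    ring_nf
  have hsum : ∑ h ∈ range (N + 1), a h • (unitK β * toQ x ^ e h * unitK (-β)) =
      unitK β * (∑ h ∈ range (N + 1), a h • toQ x ^ e h) * unitK (-β) := by
    simp only [mul_sum, sum_mul, mul_smul_comm, smul_mul_assoc]
  simp only [laurentZeta, hs, hsum]
  simp only [mul_assoc, hz]

end Laurent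

section Orthogonality

open scoped Quaternion

variable {J : QH} {A B : ℝ}

theorem imI_imJ_eq_zero_of_mul_unitK (h : J * unitK B = unitK A * J) (hAB : A + B = Real.pi) :
    J.imI = 0 ∧ J.imJ = 0 := by
  obtain rfl : A = Real.pi - B := by linarith
  have hI := congrArg (fun q : QH => q.imI) h
  have hJ := congrArg (fun q : QH => q.imJ) h
  have hs := Real.sin_sq_add_cos_sq B
  simp [Real.cos_pi_sub, Real.sin_pi_sub] at hI hJ
  constructor
  · linear_combination (-J.imI) * hs + Real.cos B / 2 * hI - Real.sin B / 2 * hJ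
  · linear_combination (-J.imJ) * hs + Real.sin B / 2 * hI + Real.cos B / 2 * hJ

theorem re_imK_eq_zero_of_mul_unitK (h : J * unitK B = unitK A * J) (hAB : A - B = Real.pi) :
    J.re = 0 ∧ J.imK = 0 := by
  obtain rfl : A = B + Real.pi := by linarith
  have hR := congrArg (fun q : QH => q.re) h
  have hK := congrArg (fun q : QH => q.imK) h
  have hs := Real.sin_sq_add_cos_sq B
  simp [Real.cos_add_pi, Real.sin_add_pi] at hR hK
  constructor
  · linear_combination (-J.re) * hs + Real.cos B / 2 * hR + Real.sin B / 2 * hK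
  · linear_combination (-J.imK) * hs - Real.sin B / 2 * hR + Real.cos B / 2 * hK

/-- The real part as a continuous linear map. -/
def reCLM : QH →L[ℝ] ℝ :=
  LinearMap.toContinuousLinearMap
    { toFun := fun q => q.re, map_add' := fun _ _ => rfl, map_smul' := fun _ _ => rfl }

/-- The `e₃`-component as a continuous linear map. -/
def imKCLM : QH →L[ℝ] ℝ :=
  LinearMap.toContinuousLinearMap
    { toFun := fun q => q.imK, map_add' := fun _ _ => rfl, map_smul' := fun _ _ => rfl }

theorem reCLM_apply (q : QH) : reCLM q = q.re := rfl

theorem imKCLM_apply (q : QH) : imKCLM q = q.imK := rfl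

variable (a a' : ℕ → ℝ) (e e' : ℕ → ℤ) (N M l m : ℕ)

/-- The integrand of the inner product of two functions `(∑ₕ aₕ x ^ eₕ) ζ ^ l` on the sphere. -/
def laurentPairing (x : R3) : QH :=
  star (laurentZeta a e N l x) * laurentZeta a' e' M m x

theorem laurentPairing_rotation (β : ℝ) (x : R3) :
    laurentPairing a a' e e' N M l m (planeRotation (2 * β) x) =
      unitK ((2 * l + 1) * β) * laurentPairing a a' e e' N M l m x *
        unitK (-((2 * m + 1) * β)) := by
  simp only [laurentPairing, laurentZeta_rotation, star_mul, star_unitK, neg_neg, mul_assoc]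
  rw [← mul_assoc (unitK (-β)) (unitK β), unitK_neg_mul_unitK, one_mul]

variable {a a' e e' N M l m}

theorem integral_laurentPairing_mul_unitK
    (hint : Integrable (fun ω : sphere (0 : R3) 1 => laurentPairing a a' e e' N M l m ω)
      (volume : Measure R3).toSphere) (β : ℝ) :
    (∫ ω : sphere (0 : R3) 1, laurentPairing a a' e e' N M l m ω
        ∂(volume : Measure R3).toSphere) * unitK ((2 * m + 1) * β) =
      unitK ((2 * l + 1) * β) * ∫ ω : sphere (0 : R3) 1, laurentPairing a a' e e' N M l m ω
        ∂(volume : Measure R3).toSphere := by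
  conv_lhs => rw [← integral_sphere_comp_isometry (planeRotation (2 * β))]
  simp only [laurentPairing_rotation]
  rw [integral_mul_const_of_integrable (hint.const_mul _), integral_const_mul_of_integrable hint,
    mul_assoc, unitK_neg_mul_unitK, mul_one]

theorem zeta_pow_imI_imJ (l : ℕ) (x : R3) : (zeta x ^ l).imI = 0 ∧ (zeta x ^ l).imJ = 0 := by
  induction l with
  | zero => simp
  | succ l ih => simp [pow_succ, ih.1, ih.2]

theorem zeta_pow_re_sq_add_imK_sq {x : R3} (hx : ‖x‖ = 1) (l : ℕ) :
    (zeta x ^ l).re ^ 2 + (zeta x ^ l).imK ^ 2 = (1 - x 0 ^ 2) ^ l := by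
  have h := sq_add_sq_add_sq_eq_one hx
  induction l with
  | zero => simp
  | succ l ih =>
    obtain ⟨hI, hJ⟩ := zeta_pow_imI_imJ l x
    rw [pow_succ _ l, pow_succ _ l, ← ih]
    simp [hI, hJ]
    linear_combination ((zeta x ^ l).re ^ 2 + (zeta x ^ l).imK ^ 2) * h

theorem laurentPairing_re_imK {x : R3} (hx : ‖x‖ = 1) :
    (laurentPairing a a' e e' N M l l x).re =
        ∑ h ∈ range (N + 1), ∑ h' ∈ range (M + 1), a h * a' h' *
          ((1 - .X ^ 2) ^ l * Polynomial.Chebyshev.T ℝ (e' h' - e h) : Polynomial ℝ).eval (x 0) ∧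
      (laurentPairing a a' e e' N M l l x).imK = 0 := by
  set q : QH := ∑ h ∈ range (N + 1), ∑ h' ∈ range (M + 1),
    (a h * a' h') • toQ x ^ (e' h' - e h) with hq
  have hP : laurentPairing a a' e e' N M l l x = star (zeta x ^ l) * q * zeta x ^ l := by
    simp only [laurentPairing, laurentZeta, star_mul, mul_assoc]
    rw [← mul_assoc (star (∑ h ∈ range (N + 1), a h • toQ x ^ e h))]
    congr 2
    rw [star_sum, sum_mul_sum]
    refine sum_congr rfl fun h _ => sum_congr rfl fun h' _ => ?_
    rw [Quaternion.star_smul, star_toQ_zpow hx, smul_mul_smul_comm, ← zpow_add₀ (toQ_ne_zero hx),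
      neg_add_eq_sub]
  have hre : q.re = ∑ h ∈ range (N + 1), ∑ h' ∈ range (M + 1), a h * a' h' *
      (Polynomial.Chebyshev.T ℝ (e' h' - e h)).eval (x 0) := by
    rw [hq, ← reCLM_apply]
    simp [reCLM_apply, (toQ_zpow_re_imK hx _).1]
  have himK : q.imK = 0 := by
    rw [hq, ← imKCLM_apply]
    simp [imKCLM_apply, (toQ_zpow_re_imK hx _).2]
  obtain ⟨hI, hJ⟩ := zeta_pow_imI_imJ l x
  have hn := zeta_pow_re_sq_add_imK_sq hx l
  rw [hP]
  constructor
  · trans (1 - x 0 ^ 2) ^ l * q.re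
    · rw [← hn]
      simp [hI, hJ, himK, -star_pow]
      ring
    · simp only [hre, mul_sum]
      refine sum_congr rfl fun h _ => sum_congr rfl fun h' _ => ?_
      simp
      ring
  · simp [hI, hJ, himK, -star_pow]
    ring

theorem integral_laurentPairing_eq_zero
    (hlm : l = m → ∑ h ∈ range (N + 1), ∑ h' ∈ range (M + 1),
      a h * a' h' * chebMoment l (e' h' - e h) = 0) :
    ∫ ω : sphere (0 : R3) 1, laurentPairing a a' e e' N M l m ω
      ∂(volume : Measure R3).toSphere = 0 := by
  by_cases hint : Integrable (fun ω : sphere (0 : R3) 1 => laurentPairing a a' e e' N M l m ω)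
      (volume : Measure R3).toSphere
  swap
  · exact integral_undef hint
  have hrot := integral_laurentPairing_mul_unitK hint
  have hIJ := imI_imJ_eq_zero_of_mul_unitK (hrot (Real.pi / (2 * (l + m + 1))))
    (by field_simp; ring)
  suffices hRK : (∫ ω : sphere (0 : R3) 1, laurentPairing a a' e e' N M l m ω
        ∂(volume : Measure R3).toSphere).re = 0 ∧
      (∫ ω : sphere (0 : R3) 1, laurentPairing a a' e e' N M l m ω
        ∂(volume : Measure R3).toSphere).imK = 0 from
    Quaternion.ext _ _ hRK.1 hIJ.1 hIJ.2 hRK.2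
  by_cases h : l = m
  · subst h
    rw [← reCLM_apply, ← imKCLM_apply, ← reCLM.integral_comp_comm hint,
      ← imKCLM.integral_comp_comm hint]
    simp only [reCLM_apply, imKCLM_apply]
    have hω : ∀ ω : sphere (0 : R3) 1, ‖(ω : R3)‖ = 1 := norm_eq_of_mem_sphere
    simp only [laurentPairing_re_imK (hω _), integral_zero, and_true]
    rw [← hlm rfl, integral_finsetSum]
    · refine sum_congr rfl fun h _ => ?_
      rw [integral_finsetSum]
      · refine sum_congr rfl fun h' _ => ?_
        rw [integral_const_mul, chebMoment]
      · exact fun h' _ => (integrable_sphere (continuous_eval_coord _)).const_mul _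
    · exact fun h _ => integrable_finsetSum _ fun h' _ =>
        (integrable_sphere (continuous_eval_coord _)).const_mul _
  · refine re_imK_eq_zero_of_mul_unitK (hrot (Real.pi / (2 * (l - m)))) ?_
    have : (l : ℝ) - m ≠ 0 := sub_ne_zero.2 (by exact_mod_cast h)
    field_simp
    ring

/-- The exponents of `x` in the restriction of an inner (`b = true`) or outer (`b = false`) Appell
function to the sphere. -/
def appellExponent (N : ℕ) (b : Bool) (h : ℕ) : ℤ :=
  if b then N - 2 * h else -1 - (N - 2 * h)

theorem sum_appellCoeff_mul_chebMoment_appellExponent (l N : ℕ) (b : Bool) (E : ℤ) (h1 : -N ≤ E)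
    (h2 : E < N) :
    ∑ h ∈ range (N + 1), appellCoeff (l + N) l h * chebMoment l (appellExponent N b h - E) = 0 := by
  cases b
  · rw [← sum_appellCoeff_mul_chebMoment l N (-1 - E) (by lia) (by lia)]
    refine sum_congr rfl fun h _ => ?_
    rw [← chebMoment_neg]
    congr 2
    simp [appellExponent]
    ring
  · simpa [appellExponent] using sum_appellCoeff_mul_chebMoment l N E h1 h2

theorem sum_sum_appellCoeff_mul_chebMoment (l : ℕ) {N M : ℕ} {b c : Bool}
    (hne : (N, b) ≠ (M, c)) :
    ∑ h ∈ range (N + 1), ∑ h' ∈ range (M + 1), appellCoeff (l + N) l h * appellCoeff (l + M) l h' *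
      chebMoment l (appellExponent M c h' - appellExponent N b h) = 0 := by
  have hbound : ∀ (K : ℕ) (d : Bool) (h : ℕ), h ∈ range (K + 1) →
      -(K : ℤ) - 1 ≤ appellExponent K d h ∧ appellExponent K d h ≤ K := fun K d h hh => by
    have := mem_range.1 hh
    cases d <;> simp [appellExponent] <;> lia
  rcases lt_trichotomy N M with hNM | rfl | hNM
  · refine sum_eq_zero fun h hh => ?_
    have := hbound N b h hh
    simp only [mul_assoc]
    rw [← mul_sum, sum_appellCoeff_mul_chebMoment_appellExponent l M c _ (by lia) (by lia), mul_zero]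
  · refine sum_eq_zero fun h _ => sum_eq_zero fun h' _ => ?_
    rw [chebMoment_of_odd, mul_zero]
    cases b <;> cases c <;> simp [appellExponent] at hne ⊢
    · exact ⟨N - h - h', by ring⟩
    · exact ⟨h + h' - N - 1, by ring⟩
  · rw [sum_comm]
    refine sum_eq_zero fun h hh => ?_
    have := hbound M c h hh
    simp only [mul_assoc]
    simp only [mul_left_comm (appellCoeff (l + N) l _) (appellCoeff (l + M) l h)]
    simp only [← chebMoment_neg l (appellExponent M c h - _), neg_sub]
    rw [← mul_sum, sum_appellCoeff_mul_chebMoment_appellExponent l N b _ (by lia) (by lia), mul_zero]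

theorem appell_eq_laurentZeta (l N : ℕ) :
    ∃ r : ℝ, ∀ x : R3, ‖x‖ = 1 → appell (l + N) l x =
      r • laurentZeta (appellCoeff (l + N) l) (appellExponent N true) N l x := by
  refine ⟨((l + N).factorial * l.factorial : ℝ) /
    (2 ^ (2 * N) * (l + N + l + 1).factorial * (2 * l).factorial), fun x hx => ?_⟩
  rw [appell, laurentZeta, Nat.add_sub_cancel_left]
  congr 2
  refine sum_congr rfl fun h hh => ?_
  have hh := mem_range.1 hh
  rw [appellCoeff, Nat.add_sub_cancel_left]
  congr 1
  rw [toQbar_eq_inv hx, ← zpow_natCast, ← zpow_natCast, inv_zpow', ← zpow_add₀ (toQ_ne_zero hx)]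
  congr 1
  simp [appellExponent]
  lia

theorem outerAppell_eq_laurentZeta (l N : ℕ) :
    ∃ r : ℝ, ∀ x : R3, ‖x‖ = 1 → outerAppell (l + N) l x =
      r • laurentZeta (appellCoeff (l + N) l) (appellExponent N false) N l x := by
  refine ⟨((l + N + l + 1).factorial * N.factorial : ℝ) /
    ((l + N).factorial * (l + N + 1).factorial) * (((l + N).factorial * l.factorial : ℝ) /
    (2 ^ (2 * N) * (l + N + l + 1).factorial * (2 * l).factorial) * (-1) ^ l), fun x hx => ?_⟩
  have hQ : toQ (barPt x) = toQbar x := rfl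
  have hQbar : toQbar (barPt x) = toQ x := by
    apply Quaternion.ext <;> simp [barPt, mk3]
  have hzeta : zeta (barPt x) = (-1 : ℝ) • zeta x := by
    apply Quaternion.ext <;> simp [barPt, mk3]
  rw [outerAppell, kelvin, hx, one_pow, one_pow, inv_one, one_smul, one_smul, appell, laurentZeta,
    Nat.add_sub_cancel_left, hQ, hQbar, hzeta, smul_pow, mul_smul_comm, mul_smul_comm,
    mul_smul_comm, smul_smul, smul_smul, ← mul_assoc, mul_sum]
  refine congrArg₂ (· • ·) (by ring) (congrArg (· * zeta x ^ l) ?_)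
  refine sum_congr rfl fun h hh => ?_
  have hh := mem_range.1 hh
  rw [appellCoeff, Nat.add_sub_cancel_left, mul_smul_comm]
  congr 1
  have h0 := toQ_ne_zero hx
  rw [toQbar_eq_inv hx, ← zpow_natCast, ← zpow_natCast, inv_zpow', ← zpow_neg_one, ← zpow_add₀ h0,
    ← zpow_add₀ h0]
  congr 1
  simp [appellExponent]
  lia

theorem psiFam_eq_laurentZeta {k : ℤ} {l : ℕ} (hk : k ≠ -1) (hl : l < (k + 1).natAbs) :
    ∃ (r : ℝ) (N : ℕ) (b : Bool), k = (if b then (l + N : ℤ) else -(l + N) - 2) ∧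
      ∀ x : R3, ‖x‖ = 1 →
        psiFam k l x = r • laurentZeta (appellCoeff (l + N) l) (appellExponent N b) N l x := by
  by_cases hk0 : 0 ≤ k
  · obtain ⟨N, hN⟩ : ∃ N : ℕ, k = l + N := ⟨(k - l).toNat, by lia⟩
    obtain ⟨r, hr⟩ := appell_eq_laurentZeta l N
    refine ⟨r, N, true, by simpa using hN, fun x hx => ?_⟩
    rw [psiFam, if_pos hk0, ← hr x hx, show k.toNat = l + N by lia]
  · obtain ⟨N, hN⟩ : ∃ N : ℕ, k = -(l + N) - 2 := ⟨(-k - 2 - l).toNat, by lia⟩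
    obtain ⟨r, hr⟩ := outerAppell_eq_laurentZeta l N
    refine ⟨r, N, false, by simpa using hN, fun x hx => ?_⟩
    rw [psiFam, if_neg hk0, ← hr x hx, show (-k - 2).toNat = l + N by lia]

end Orthogonality

theorem appell_smul {n l : ℕ} (hl : l ≤ n) (r : ℝ) (x : R3) :
    appell n l (r • x) = r ^ n • appell n l x := by
  have hQ : toQ (r • x) = r • toQ x := by
    apply Quaternion.ext <;> simp
  have hQbar : toQbar (r • x) = r • toQbar x := by
    apply Quaternion.ext <;> simp
  have hzeta : zeta (r • x) = r • zeta x := by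
    apply Quaternion.ext <;> simp
  rw [appell, appell, smul_comm (r ^ n), hQ, hQbar, hzeta]
  congr 1
  rw [sum_mul, sum_mul, smul_sum]
  refine sum_congr rfl fun h hh => ?_
  have hh := mem_range.1 hh
  have hpow : r ^ n = r ^ h * r ^ (n - l - h) * r ^ l := by
    rw [← pow_add, ← pow_add, show h + (n - l - h) + l = n by lia]
  simp only [hpow, smul_pow, smul_mul_assoc, mul_smul_comm, smul_smul]
  congr 1
  ring

theorem integral_ball_norm_appell_sq {n l : ℕ} (hl : l ≤ n) :
    ∫ x in ball (0 : R3) 1, ‖appell n l x‖ ^ 2 =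
      (2 * (n : ℝ) + 3)⁻¹ * ∫ ω : sphere (0 : R3) 1, ‖appell n l (ω : R3)‖ ^ 2
        ∂(volume : Measure R3).toSphere := by
  rw [← integral_indicator measurableSet_ball,
    integral_polar _ (fun x => ‖appell n l x‖ ^ 2)
      ((Set.Iio (1 : ℝ)).indicator fun r => r ^ (2 * n)) fun r hr ω hω => ?_, smul_eq_mul]
  · congr 1
    have h : ∀ r : ℝ, r ^ 2 * (Set.Iio (1 : ℝ)).indicator (fun r => r ^ (2 * n)) r =
        (Set.Iio (1 : ℝ)).indicator (fun r => r ^ (2 * n + 2)) r := fun r => by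
      by_cases hr : r ∈ Set.Iio (1 : ℝ) <;> simp [hr, pow_add, mul_comm]
    simp only [h]
    rw [setIntegral_indicator measurableSet_Iio, Set.Ioi_inter_Iio, ← integral_Ioc_eq_integral_Ioo,
      ← intervalIntegral.integral_of_le zero_le_one, integral_pow]
    push_cast
    simp
    ring
  · have hr1 : r • ω ∈ ball (0 : R3) 1 ↔ r ∈ Set.Iio (1 : ℝ) := by
      simp [norm_smul, hω, abs_of_pos hr]
    by_cases hr' : r ∈ Set.Iio (1 : ℝ)
    · rw [Set.indicator_of_mem (hr1.2 hr'), Set.indicator_of_mem hr', appell_smul hl, norm_smul,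
        norm_pow, Real.norm_of_nonneg hr.le, smul_eq_mul]
      ring
    · rw [Set.indicator_of_notMem (hr1.not.2 hr'), Set.indicator_of_notMem hr', zero_smul]

/-- orthogonality of the unified family ψ_k^l over the unit sphere,
and the relation between the spherical and solid norms of the Appell polynomials. -/
theorem sphere_orthogonality :
    (∀ (k q : ℤ) (l m : ℕ), k ≠ -1 → q ≠ -1 →
      l < (k + 1).natAbs → m < (q + 1).natAbs → (k, l) ≠ (q, m) →
      ∫ ω : sphere (0 : R3) 1,
        star (psiFam k l (ω : R3)) * psiFam q m (ω : R3)
          ∂((volume : Measure R3).toSphere) = 0) ∧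
    (∀ n l : ℕ, l ≤ n →
      ∫ ω : sphere (0 : R3) 1, ‖appell n l (ω : R3)‖ ^ 2
          ∂((volume : Measure R3).toSphere) =
        (2 * (n : ℝ) + 3) * ∫ x in ball (0 : R3) 1, ‖appell n l x‖ ^ 2) := by 
  refine ⟨fun k q l m hk hq hl hm hne => ?_, fun n l hl => ?_⟩
  · obtain ⟨r, N, b, rfl, hf⟩ := psiFam_eq_laurentZeta hk hl
    obtain ⟨s, M, c, rfl, hg⟩ := psiFam_eq_laurentZeta hq hm
    have hω : ∀ ω : sphere (0 : R3) 1, ‖(ω : R3)‖ = 1 := norm_eq_of_mem_sphere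
    simp only [hf _ (hω _), hg _ (hω _), Quaternion.star_smul, smul_mul_smul_comm, integral_smul]
    refine smul_eq_zero_of_right _ (integral_laurentPairing_eq_zero fun hlm => ?_)
    subst hlm
    refine sum_sum_appellCoeff_mul_chebMoment l fun h => hne ?_
    rw [Prod.mk.injEq] at h
    rw [h.1, h.2]
  · have : (2 * (n : ℝ) + 3) ≠ 0 := by positivity
    rw [integral_ball_norm_appell_sq hl, mul_inv_cancel_left₀ this]
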